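/- Let v be a weight on ℝⁿ which is not essentially bounded (ess sup v = ∞). Then there exists a strictly increasing sequence α_k → ∞ with the following property: for every sequence of numbers 0 < δ_k < 1 there exist pairwise disjoint cubes Q_k and measurable subsets E_k ⊆ Q_k with |E_k| ≥ δ_k|Q_k| such that α_k < v(x) ≤ 2α_k for every x ∈ E_k. -/

import Mathlib

open MeasureTheory ENNReal Filter

noncomputable section

/-- A (half-open) cube in `ℝⁿ`. -/
structure Cube (n : ℕ) where
  corner : Fin n → ℝ
  side : ℝ
  side_pos : 0 < side

/-- The underlying set of a cube. -/
def Cube.set {n : ℕ} (Q : Cube n) : Set (Fin n → ℝ) :=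
  Set.univ.pi fun i => Set.Ico (Q.corner i) (Q.corner i + Q.side)

/-- A weight: a non-negative, locally integrable function. -/
def IsWeight {n : ℕ} (w : (Fin n → ℝ) → ℝ) : Prop :=
  Measurable w ∧ (∀ x, 0 ≤ w x) ∧ LocallyIntegrable w volume

/-- A sparse family of cubes with sparseness constant `α`. -/
def IsSparse {n : ℕ} (S : Set (Cube n)) (α : ℝ) : Prop :=
  ∃ E : Cube n → Set (Fin n → ℝ),
    (∀ Q ∈ S, E Q ⊆ Q.set ∧ MeasurableSet (E Q) ∧
      ENNReal.ofReal α * volume Q.set ≤ volume (E Q)) ∧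
    S.Pairwise fun Q Q' => Disjoint (E Q) (E Q')

/-- An injective sequence in a metric space has a subsequence whose points are the centres of
pairwise disjoint balls. -/
theorem exists_strictMono_pairwise_disjoint_ball {X : Type*} [MetricSpace X] (x : ℕ → X)
    (hx : Function.Injective x) :
    ∃ φ : ℕ → ℕ, StrictMono φ ∧ ∃ r : ℕ → ℝ, (∀ k, 0 < r k) ∧
      Pairwise fun k l => Disjoint (Metric.ball (x (φ k)) (r k)) (Metric.ball (x (φ l)) (r l)) := by
  have : Infinite (Set.range x) := (Set.infinite_range_of_injective hx).to_subtype
  obtain ⟨U, hUinf, hUo, hUd⟩ := exists_seq_infinite_isOpen_pairwise_disjoint (Set.range x)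
  let y : ℕ → Set.range x := fun k => ⟨x k, k, rfl⟩
  have hy : Function.Surjective y := by
    rintro ⟨_, k, rfl⟩
    exact ⟨k, rfl⟩
  have hfreq : ∀ k, ∃ᶠ j in atTop, y j ∈ U k := fun k =>
    Nat.frequently_atTop_iff_infinite.2 ((hUinf k).preimage fun z _ => hy z)
  obtain ⟨φ, hφ, hφU⟩ := extraction_forall_of_frequently hfreq
  have hball : ∀ k, ∃ r > 0, Metric.ball (y (φ k)) r ⊆ U k := fun k =>
    Metric.isOpen_iff.1 (hUo k) _ (hφU k)
  choose r hr hrU using hball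
  refine ⟨φ, hφ, fun k => r k / 2, fun k => half_pos (hr k), fun k l hkl => ?_⟩
  have hdist : ∀ k l, k ≠ l → r k ≤ dist (x (φ l)) (x (φ k)) := by
    intro k l hkl
    by_contra! h
    exact Set.disjoint_left.1 (hUd hkl) (hrU k (Metric.mem_ball.2 h)) (hφU l)
  refine Metric.ball_disjoint_ball ?_
  have h₁ := hdist k l hkl
  have h₂ := hdist l k hkl.symm
  rw [dist_comm] at h₁
  linarith

/-- A function that is not essentially bounded takes values in infinitely many dyadic intervals
`(2 ^ j, 2 ^ (j + 1)]` on sets of positive measure. -/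
theorem frequently_measure_dyadic_ne_zero {X : Type*} [MeasurableSpace X] (μ : Measure X)
    (v : X → ℝ) (hunb : ¬ ∃ M : ℝ, ∀ᵐ x ∂μ, v x ≤ M) :
    ∃ᶠ j : ℕ in atTop, μ (v ⁻¹' Set.Ioc (2 ^ j) (2 * 2 ^ j)) ≠ 0 := by
  intro h
  obtain ⟨N, hN⟩ := eventually_atTop.1 h
  refine hunb ⟨2 ^ N, ?_⟩
  have hall : ∀ᵐ x ∂μ, ∀ j : ℕ, N ≤ j → x ∉ v ⁻¹' Set.Ioc (2 ^ j) (2 * 2 ^ j) := by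
    refine ae_all_iff.2 fun j => ?_
    by_cases hj : N ≤ j
    · filter_upwards [measure_eq_zero_iff_ae_notMem.1 (not_not.1 (hN j hj))] with x hx _ using hx
    · exact .of_forall fun x h' => absurd h' hj
  filter_upwards [hall] with x hx
  by_contra! hlt
  have hex : ∃ j : ℕ, v x ≤ 2 ^ j := by
    obtain ⟨j, hj⟩ := pow_unbounded_of_one_lt (v x) one_lt_two
    exact ⟨j, hj.le⟩
  classical
  have hNlt : N < Nat.find hex := by
    refine (Nat.lt_find_iff hex N).2 fun m hm => not_le.2 (lt_of_le_of_lt ?_ hlt)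
    exact pow_le_pow_right₀ one_le_two hm
  obtain ⟨j, hj⟩ := Nat.exists_eq_add_of_lt hNlt
  refine hx (N + j) (Nat.le_add_right _ _) ⟨not_le.1 (Nat.find_min hex (by omega)), ?_⟩
  rw [← pow_succ', ← hj]
  exact Nat.find_spec hex

/-- The cube with centre `x` and side `2 * r`. -/
def Cube.centered {n : ℕ} (x : Fin n → ℝ) (r : ℝ) (hr : 0 < r) : Cube n where
  corner i := x i - r
  side := 2 * r
  side_pos := by positivity

theorem Cube.measurableSet {n : ℕ} (Q : Cube n) : MeasurableSet Q.set :=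
  .univ_pi fun _ => measurableSet_Ico

theorem Cube.set_centered_eq {n : ℕ} (x : Fin n → ℝ) (r : ℝ) (hr : 0 < r) :
    (Cube.centered x r hr).set = Set.univ.pi fun i => Set.Ico (x i - r) (x i + r) := by
  simp only [Cube.set, Cube.centered]
  congr! 3
  ring

theorem closedBall_eq_univ_pi_Icc {n : ℕ} (x : Fin n → ℝ) {r : ℝ} (hr : 0 ≤ r) :
    Metric.closedBall x r = Set.univ.pi fun i => Set.Icc (x i - r) (x i + r) := by
  simp only [closedBall_pi x hr, Real.closedBall_eq_Icc]

theorem Cube.set_centered_subset {n : ℕ} (x : Fin n → ℝ) (r : ℝ) (hr : 0 < r) :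
    (Cube.centered x r hr).set ⊆ Metric.closedBall x r := by
  rw [Cube.set_centered_eq, closedBall_eq_univ_pi_Icc x hr.le]
  exact Set.pi_mono fun _ _ => Set.Ico_subset_Icc_self

theorem Cube.set_centered_ae_eq {n : ℕ} (x : Fin n → ℝ) (r : ℝ) (hr : 0 < r) :
    (Cube.centered x r hr).set =ᵐ[volume] Metric.closedBall x r := by
  rw [Cube.set_centered_eq, closedBall_eq_univ_pi_Icc x hr.le, Set.pi_univ_Icc]
  exact Measure.univ_pi_Ico_ae_eq_Icc

/-- Around a density point of `A`, arbitrarily small centered cubes are filled by `A` up to any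
proportion `δ < 1`. -/
theorem exists_centered_cube_of_density {n : ℕ} {A : Set (Fin n → ℝ)} {x : Fin n → ℝ}
    (hx : Tendsto (fun r => volume (A ∩ Metric.closedBall x r) / volume (Metric.closedBall x r))
      (nhdsWithin 0 (Set.Ioi 0)) (nhds 1))
    {δ R : ℝ} (hδ : δ < 1) (hR : 0 < R) :
    ∃ Q : Cube n, Q.set ⊆ Metric.ball x R ∧
      ENNReal.ofReal δ * volume Q.set ≤ volume (A ∩ Q.set) := by
  have hδ' : ENNReal.ofReal δ < 1 := ENNReal.ofReal_lt_one.2 hδ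
  obtain ⟨r, hrδ, hr, hrR⟩ :=
    ((hx.eventually (lt_mem_nhds hδ')).and (Ioo_mem_nhdsGT hR)).exists
  refine ⟨Cube.centered x r hr,
    (Cube.set_centered_subset x r hr).trans (Metric.closedBall_subset_ball hrR), ?_⟩
  have hae := Cube.set_centered_ae_eq x r hr
  rw [measure_congr hae, measure_congr ((ae_eq_refl A).inter hae)]
  exact ENNReal.mul_le_of_le_div hrδ.le

/-- **Proposition: decomposition of an essentially unbounded weight.** -/
theorem unbounded_weight_selection (n : ℕ) (v : (Fin n → ℝ) → ℝ)
    (hv : IsWeight v)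
    (hunb : ¬ ∃ M : ℝ, ∀ᵐ x ∂(volume : Measure (Fin n → ℝ)), v x ≤ M) :
    ∃ a : ℕ → ℝ, StrictMono a ∧ Tendsto a atTop atTop ∧
      ∀ δ : ℕ → ℝ, (∀ k, 0 < δ k ∧ δ k < 1) →
        ∃ (Q : ℕ → Cube n) (E : ℕ → Set (Fin n → ℝ)),
          (Pairwise fun k l => Disjoint (Q k).set (Q l).set) ∧
          ∀ k, MeasurableSet (E k) ∧ E k ⊆ (Q k).set ∧
            ENNReal.ofReal (δ k) * volume (Q k).set ≤ volume (E k) ∧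
            ∀ x ∈ E k, a k < v x ∧ v x ≤ 2 * a k := by
  obtain ⟨φ, hφ, hpos⟩ :=
    extraction_of_frequently_atTop (frequently_measure_dyadic_ne_zero volume v hunb)
  let A : ℕ → Set (Fin n → ℝ) := fun k => v ⁻¹' Set.Ioc (2 ^ φ k) (2 * 2 ^ φ k)
  have hA : ∀ k, MeasurableSet (A k) := fun k => hv.1 measurableSet_Ioc
  have hdens : ∀ k, ∃ x ∈ A k,
      Tendsto (fun r => volume (A k ∩ Metric.closedBall x r) / volume (Metric.closedBall x r))
        (nhdsWithin 0 (Set.Ioi 0)) (nhds 1) := by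
    intro k
    have : NeBot (ae (volume.restrict (A k))) := by
      rw [ae_neBot, Ne, Measure.restrict_eq_zero]
      exact hpos k
    exact ((ae_restrict_mem (hA k)).and
      (Besicovitch.ae_tendsto_measure_inter_div volume (A k))).exists
  choose x hxA hx using hdens
  have hlt : ∀ k l, k < l → v (x k) < v (x l) := fun k l hkl => by
    refine ((hxA k).2.trans ?_).trans_lt (hxA l).1
    rw [← pow_succ']
    exact pow_le_pow_right₀ one_le_two (hφ hkl)
  have hinj : Function.Injective x :=
    Function.Injective.of_comp (f := v) (strictMono_nat_of_lt_succ fun k =>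
      hlt k (k + 1) k.lt_succ_self).injective
  obtain ⟨ψ, hψ, R, hR, hdisj⟩ := exists_strictMono_pairwise_disjoint_ball x hinj
  have hmono : StrictMono fun k => φ (ψ k) := hφ.comp hψ
  refine ⟨fun k => 2 ^ φ (ψ k), (pow_right_strictMono₀ _root_.one_lt_two).comp hmono,
    (tendsto_pow_atTop_atTop_of_one_lt _root_.one_lt_two).comp hmono.tendsto_atTop, fun δ hδ => ?_⟩
  choose Q hQ hQA using fun k => exists_centered_cube_of_density (hx (ψ k)) (hδ k).2 (hR k)
  exact ⟨Q, fun k => A (ψ k) ∩ (Q k).set, fun k l hkl => (hdisj hkl).mono (hQ k) (hQ l),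
    fun k => ⟨(hA _).inter (Q k).measurableSet, Set.inter_subset_right, hQA k,
      fun _ hy => hy.1⟩⟩

end
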